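/- The graph D₁ is a minimal non-word-representable graph: D₁ is not word-representable, but for every vertex v of D₁, the induced subgraph of D₁ obtained by deleting v is word-representable. Here D₁ is the split graph with vertex set {1,2,3,4,5,6} ∪ {a,b,c,d}, in which {1,2,3,4,5,6} induces a complete graph, {a,b,c,d} is an independent set, and the remaining edges are exactly: a adjacent to 1, 3, 5; b adjacent to 1, 2; c adjacent to 3, 4; d adjacent to 5, 6. -/

import Mathlib

/-- Two distinct letters `x` and `y` alternate in a word `w` if the subsequence of `w`
obtained by deleting all letters other than `x` and `y` has no two equal consecutive
letters (i.e. it is of the form `xyxy...` or `yxyx...`). -/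
def Alternates {V : Type*} [DecidableEq V] (w : List V) (x y : V) : Prop :=
  (w.filter fun z => decide (z = x ∨ z = y)).Chain' (· ≠ ·)

/-- `w` is a word representing the graph `G`: every vertex occurs in `w`, and two distinct
vertices alternate in `w` iff they are adjacent in `G`. -/
def WordRepresents {V : Type*} [DecidableEq V] (G : SimpleGraph V) (w : List V) : Prop :=
  (∀ v : V, v ∈ w) ∧ ∀ x y : V, x ≠ y → (Alternates w x y ↔ G.Adj x y)

/-- A graph is word-representable if some word represents it. -/
def WordRepresentable {V : Type*} [DecidableEq V] (G : SimpleGraph V) : Prop :=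
  ∃ w : List V, WordRepresents G w
/-- Neighborhoods in the clique `{1,…,6}` (represented by `Fin 6`, with vertex `i+1`
represented by `i`) of the independent vertices `a, b, c, d` (represented by `Fin 4`):
`a` is adjacent to `1,3,5`; `b` to `1,2`; `c` to `3,4`; `d` to `5,6`. -/
def D1nbr : Fin 4 → Finset (Fin 6)
  | 0 => {0, 2, 4}
  | 1 => {0, 1}
  | 2 => {2, 3}
  | 3 => {4, 5}

/-- The split graph `D₁`: the clique `{1,…,6}` (as `Fin 6`), the independent set
`{a,b,c,d}` (as `Fin 4`), and edges between them given by `D1nbr`. -/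
def D1 : SimpleGraph (Fin 6 ⊕ Fin 4) :=
  SimpleGraph.fromRel fun u v =>
    match u, v with
    | Sum.inl _, Sum.inl _ => True
    | Sum.inl i, Sum.inr a => i ∈ D1nbr a
    | _, _ => False

/-- The number of occurrences of `x` in the prefixes of `w`, as a function of their length. -/
def prefixCount {V : Type*} [DecidableEq V] (w : List V) (x : V) (n : ℕ) : ℕ :=
  (w.take n).count x

/-- `g` is squeezed between `f` and `f + 1`. -/
def WithinOne (f g : ℕ → ℕ) : Prop :=
  ∀ n, f n ≤ g n ∧ g n ≤ f n + 1

theorem withinOne_prefixCount_cons {V : Type*} [DecidableEq V] (w : List V) (z x y : V) :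
    WithinOne (prefixCount (z :: w) y) (prefixCount (z :: w) x) ↔
      ∀ n, (w.take n).count y + (if z = y then 1 else 0) ≤
          (w.take n).count x + (if z = x then 1 else 0) ∧
        (w.take n).count x + (if z = x then 1 else 0) ≤
          (w.take n).count y + (if z = y then 1 else 0) + 1 := by
  constructor
  · intro h n
    simpa [prefixCount, List.count_cons] using h (n + 1)
  · rintro h (_ | n)
    · simp [prefixCount]
    · simpa [prefixCount, List.count_cons] using h n

theorem withinOne_prefixCount_iff_isChain {V : Type*} [DecidableEq V] (w : List V) {x y : V}
    (hxy : x ≠ y) :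
    WithinOne (prefixCount w y) (prefixCount w x) ↔
      (y :: w.filter fun z => decide (z = x ∨ z = y)).IsChain (· ≠ ·) := by
  induction w generalizing x y with
  | nil => simp [WithinOne, prefixCount]
  | cons z w ih =>
    rw [withinOne_prefixCount_cons]
    by_cases hx : z = x
    · subst hx
      have hswap : (fun t => decide (t = z ∨ t = y)) = fun t => decide (t = y ∨ t = z) := by
        simp only [or_comm]
      have hstep := ih hxy.symm
      rw [← hswap] at hstep
      simp only [List.filter_cons, true_or, decide_true, if_true, List.isChain_cons_cons,
        ← hstep, if_neg hxy]
      refine ⟨fun h => ⟨hxy.symm, fun n => ?_⟩, fun h n => ?_⟩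
      · have := h n
        simp only [prefixCount]
        omega
      · have := h.2 n
        simp only [prefixCount] at this
        omega
    · by_cases hy : z = y
      · subst hy
        simp only [List.filter_cons, or_true, decide_true, if_true, List.isChain_cons_cons,
          ne_eq, not_true_eq_false, false_and, iff_false, if_neg hx]
        intro h
        simpa using h 0
      · simpa [List.filter_cons, hx, hy, WithinOne, prefixCount] using ih hxy

/-- Two letters alternate iff one of them always leads the other by at most one occurrence. -/
theorem alternates_iff_withinOne {V : Type*} [DecidableEq V] (w : List V) {x y : V}
    (hxy : x ≠ y) :
    Alternates w x y ↔
      WithinOne (prefixCount w x) (prefixCount w y) ∨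
        WithinOne (prefixCount w y) (prefixCount w x) := by
  have hswap : (fun t => decide (t = y ∨ t = x)) = fun t => decide (t = x ∨ t = y) := by
    simp only [or_comm]
  rw [withinOne_prefixCount_iff_isChain w hxy, withinOne_prefixCount_iff_isChain w hxy.symm,
    hswap, Alternates]
  have hmem : ∀ t ∈ w.filter (fun t => decide (t = x ∨ t = y)), t = x ∨ t = y := by
    simp
  generalize w.filter (fun t => decide (t = x ∨ t = y)) = l at hmem
  change l.IsChain _ ↔ _
  cases l with
  | nil => simp
  | cons t l =>
    rcases hmem t List.mem_cons_self with rfl | rfl <;>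
      simp [List.isChain_cons_cons, hxy, hxy.symm]

/-- Counting functions that stay within one of each other are alternating. -/
def CountsAlternate (f g : ℕ → ℕ) : Prop :=
  WithinOne f g ∨ WithinOne g f

theorem CountsAlternate.le_or_le {f g : ℕ → ℕ} (h : CountsAlternate f g) : f ≤ g ∨ g ≤ f :=
  h.imp (fun h n => (h n).1) (fun h n => (h n).1)

theorem CountsAlternate.le_add_one {f g : ℕ → ℕ} (h : CountsAlternate f g) (n : ℕ) :
    g n ≤ f n + 1 := by
  rcases h with h | h <;> have := h n <;> omega

theorem countsAlternate_or_of_chain_odd {a b c d x : ℕ → ℕ} (hab : a ≤ b) (hbc : b ≤ c)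
    (hcd : c ≤ d) (hda : ∀ n, d n ≤ a n + 1) (ha : CountsAlternate x a)
    (hc : CountsAlternate x c) : CountsAlternate x b ∨ CountsAlternate x d := by
  have key : ∀ n, a n ≤ b n ∧ b n ≤ c n ∧ c n ≤ d n ∧ d n ≤ a n + 1 :=
    fun n => ⟨hab n, hbc n, hcd n, hda n⟩
  rcases ha with ha | ha <;> rcases hc with hc | hc
  · exact .inl (.inl fun n => by have := key n; have := ha n; have := hc n; omega)
  · exact .inl (.inl fun n => by have := key n; have := ha n; have := hc n; omega)
  · exact .inr (.inl fun n => by have := key n; have := ha n; have := hc n; omega)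
  · exact .inl (.inr fun n => by have := key n; have := ha n; have := hc n; omega)

theorem countsAlternate_or_of_chain_even {a b c d x : ℕ → ℕ} (hab : a ≤ b) (hbc : b ≤ c)
    (hcd : c ≤ d) (hda : ∀ n, d n ≤ a n + 1) (hb : CountsAlternate x b)
    (hd : CountsAlternate x d) : CountsAlternate x a ∨ CountsAlternate x c := by
  have key : ∀ n, a n ≤ b n ∧ b n ≤ c n ∧ c n ≤ d n ∧ d n ≤ a n + 1 :=
    fun n => ⟨hab n, hbc n, hcd n, hda n⟩
  rcases hb with hb | hb <;> rcases hd with hd | hd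
  · exact .inr (.inl fun n => by have := key n; have := hb n; have := hd n; omega)
  · exact .inr (.inl fun n => by have := key n; have := hb n; have := hd n; omega)
  · exact .inl (.inr fun n => by have := key n; have := hb n; have := hd n; omega)
  · exact .inr (.inr fun n => by have := key n; have := hb n; have := hd n; omega)

/-- `a`, `b`, `c` are met in this cyclic order. -/
def Cyclic {α : Type*} [Preorder α] (a b c : α) : Prop :=
  (a < b ∧ b < c) ∨ (b < c ∧ c < a) ∨ (c < a ∧ a < b)

theorem Cyclic.rotate {α : Type*} [Preorder α] {a b c : α} (h : Cyclic a b c) :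
    Cyclic b c a := by
  unfold Cyclic at *
  tauto

theorem cyclic_or_cyclic {α : Type*} [Preorder α] {a b c : α} (hab : a < b ∨ b < a)
    (hbc : b < c ∨ c < b) (hac : a < c ∨ c < a) : Cyclic a b c ∨ Cyclic a c b := by
  unfold Cyclic
  tauto

/-- Inserting a point into a cyclically ordered triple. -/
theorem Cyclic.insert {α : Type*} [Preorder α] {a b c t : α} (h : Cyclic a b c)
    (hta : t < a ∨ a < t) (htb : t < b ∨ b < t) (htc : t < c ∨ c < t) :
    (Cyclic a t b ∧ Cyclic b c t ∧ Cyclic c a t) ∨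
      (Cyclic b t c ∧ Cyclic c a t ∧ Cyclic a b t) ∨
      (Cyclic c t a ∧ Cyclic a b t ∧ Cyclic b c t) := by
  unfold Cyclic at *
  grind

/-- The letters of a clique that alternate with `x` are not separated by two letters that do
not. -/
theorem countsAlternate_or_of_cyclic {ι : Type*} {f : ι → ℕ → ℕ} {x : ℕ → ℕ}
    (hf : ∀ i j, ∀ n, f j n ≤ f i n + 1) {p q r s : ι}
    (hpqr : Cyclic (f p) (f q) (f r)) (hrsp : Cyclic (f r) (f s) (f p))
    (hp : CountsAlternate x (f p)) (hr : CountsAlternate x (f r)) :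
    CountsAlternate x (f q) ∨ CountsAlternate x (f s) := by
  have odd : ∀ {p q r s : ι}, f p < f q → f q < f r → f r < f s →
      CountsAlternate x (f p) → CountsAlternate x (f r) →
      CountsAlternate x (f q) ∨ CountsAlternate x (f s) := fun h₁ h₂ h₃ =>
    countsAlternate_or_of_chain_odd h₁.le h₂.le h₃.le (hf _ _)
  have even : ∀ {p q r s : ι}, f p < f q → f q < f r → f r < f s →
      CountsAlternate x (f q) → CountsAlternate x (f s) →
      CountsAlternate x (f p) ∨ CountsAlternate x (f r) := fun h₁ h₂ h₃ =>
    countsAlternate_or_of_chain_even h₁.le h₂.le h₃.le (hf _ _)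
  rcases hpqr with ⟨h₁, h₂⟩ | ⟨h₁, h₂⟩ | ⟨h₁, h₂⟩ <;>
    rcases hrsp with ⟨h₃, h₄⟩ | ⟨h₃, h₄⟩ | ⟨h₃, h₄⟩
  · exact absurd (h₁.trans (h₂.trans (h₃.trans h₄))) (lt_irrefl _)
  · exact (even h₃ h₁ h₂ hp hr).symm
  · exact odd h₁ h₂ h₄ hp hr
  · exact even h₁ h₃ h₄ hr hp
  · exact absurd (h₂.trans h₄) (lt_irrefl _)
  · exact absurd (h₂.trans h₃) (lt_irrefl _)
  · exact (odd h₃ h₄ h₂ hr hp).symm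
  · exact absurd (h₁.trans h₄) (lt_irrefl _)
  · exact absurd (h₁.trans h₃) (lt_irrefl _)

theorem D1_adj_inl_inl {i j : Fin 6} : D1.Adj (Sum.inl i) (Sum.inl j) ↔ i ≠ j := by
  simp [D1]

theorem D1_adj_inr_inl {a : Fin 4} {i : Fin 6} :
    D1.Adj (Sum.inr a) (Sum.inl i) ↔ i ∈ D1nbr a := by
  simp [D1]

theorem D1_adj_inl_inr {a : Fin 4} {i : Fin 6} :
    D1.Adj (Sum.inl i) (Sum.inr a) ↔ i ∈ D1nbr a := by
  simp [D1]

theorem not_D1_adj_inr_inr {a b : Fin 4} : ¬ D1.Adj (Sum.inr a) (Sum.inr b) := by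
  simp [D1]

theorem not_wordRepresentable_D1 : ¬ WordRepresentable D1 := by
  rintro ⟨w, -, hw⟩
  let f : Fin 6 → ℕ → ℕ := fun i => prefixCount w (Sum.inl i)
  let g : Fin 4 → ℕ → ℕ := fun a => prefixCount w (Sum.inr a)
  have hclique : ∀ i j, i ≠ j → CountsAlternate (f i) (f j) := fun i j hij =>
    (alternates_iff_withinOne w (by simpa using hij)).1
      ((hw _ _ (by simpa using hij)).2 (D1_adj_inl_inl.2 hij))
  have hnbr : ∀ a i, CountsAlternate (g a) (f i) ↔ i ∈ D1nbr a := fun a i =>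
    (alternates_iff_withinOne w (by simp)).symm.trans
      ((hw _ _ (by simp)).trans D1_adj_inr_inl)
  have hclose : ∀ i j, ∀ n, f j n ≤ f i n + 1 := by
    intro i j
    by_cases hij : i = j
    · subst hij
      exact fun n => Nat.le_succ _
    · exact (hclique i j hij).le_add_one
  have hlt : ∀ i j, i ≠ j → f i < f j ∨ f j < f i := by
    intro i j hij
    have hne : f i ≠ f j := by
      intro heq
      have hsame : ∀ a, i ∈ D1nbr a ↔ j ∈ D1nbr a := fun a => by
        rw [← hnbr, ← hnbr, heq]
      have hdistinct : ∀ i j : Fin 6, (∀ a, i ∈ D1nbr a ↔ j ∈ D1nbr a) → i = j := by decide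
      exact hij (hdistinct i j hsame)
    exact (hclique i j hij).le_or_le.imp hne.lt_of_le hne.symm.lt_of_le
  have hsep : ∀ a {p q r s}, Cyclic (f p) (f q) (f r) → Cyclic (f r) (f s) (f p) →
      p ∈ D1nbr a → r ∈ D1nbr a → q ∉ D1nbr a → s ∉ D1nbr a → False := by
    intro a p q r s hpqr hrsp hp hr hq hs
    rcases countsAlternate_or_of_cyclic hclose hpqr hrsp ((hnbr a p).2 hp) ((hnbr a r).2 hr)
      with h | h
    · exact hq ((hnbr a q).1 h)
    · exact hs ((hnbr a s).1 h)
  -- The second neighbour of a vertex of degree two avoids the arc opposite to the first one.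
  have harc : ∀ b {i j k i'}, Cyclic (f i) (f j) (f k) → i ∈ D1nbr b → i' ∈ D1nbr b →
      j ∉ D1nbr b → k ∉ D1nbr b → i ≠ i' →
      (Cyclic (f i) (f i') (f j) ∨ Cyclic (f k) (f i') (f i)) ∧ Cyclic (f j) (f k) (f i') := by
    intro b i j k i' h hi hi' hj hk hne
    rcases h.insert (hlt i' i hne.symm) (hlt i' j (ne_of_mem_of_not_mem hi' hj))
      (hlt i' k (ne_of_mem_of_not_mem hi' hk)) with h' | h' | h'
    · exact ⟨.inl h'.1, h'.2.1⟩
    · exact (hsep b h'.2.2 h'.2.1.rotate.rotate hi hi' hj hk).elim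
    · exact ⟨.inr h'.1, h'.2.2⟩
  have hcyc : ∀ b c d i j k i' j' k', Cyclic (f i) (f j) (f k) →
      i ∈ D1nbr 0 ∧ j ∈ D1nbr 0 ∧ k ∈ D1nbr 0 → i' ∉ D1nbr 0 ∧ j' ∉ D1nbr 0 ∧ k' ∉ D1nbr 0 →
      i ∈ D1nbr b ∧ i' ∈ D1nbr b ∧ j ∉ D1nbr b ∧ k ∉ D1nbr b →
      j ∈ D1nbr c ∧ j' ∈ D1nbr c ∧ k ∉ D1nbr c ∧ i ∉ D1nbr c →
      k ∈ D1nbr d ∧ k' ∈ D1nbr d ∧ i ∉ D1nbr d ∧ j ∉ D1nbr d → False := by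
    rintro b c d i j k i' j' k' h ⟨hi, hj, hk⟩ ⟨hi', hj', hk'⟩ ⟨hb₁, hb₂, hb₃, hb₄⟩
      ⟨hc₁, hc₂, hc₃, hc₄⟩ ⟨hd₁, hd₂, hd₃, hd₄⟩
    have hij' := (harc c h.rotate hc₁ hc₂ hc₃ hc₄ (ne_of_mem_of_not_mem hj hj')).2
    have hik' := (harc d h.rotate.rotate hd₁ hd₂ hd₃ hd₄ (ne_of_mem_of_not_mem hk hk')).2
    rcases (harc b h hb₁ hb₂ hb₃ hb₄ (ne_of_mem_of_not_mem hi hi')).1 with h₁ | h₁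
    · exact hsep 0 h₁ hik'.rotate hi hj hi' hk'
    · exact hsep 0 h₁ hij'.rotate hk hi hi' hj'
  rcases cyclic_or_cyclic (hlt 0 2 (by decide)) (hlt 2 4 (by decide)) (hlt 0 4 (by decide))
    with h | h
  · exact hcyc 1 2 3 0 2 4 1 3 5 h (by decide) (by decide) (by decide) (by decide) (by decide)
  · exact hcyc 1 3 2 0 4 2 1 5 3 h (by decide) (by decide) (by decide) (by decide) (by decide)

/-- A word avoiding `v` that represents `G` away from `v` represents the vertex-deleted graph. -/
theorem wordRepresentable_induce_ne {V : Type*} [DecidableEq V] {G : SimpleGraph V} {v : V}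
    (w : List V) (hmem : ∀ x, x ∈ w ↔ x ≠ v)
    (hadj : ∀ x y, x ≠ v → y ≠ v → x ≠ y → (Alternates w x y ↔ G.Adj x y)) :
    WordRepresentable (G.induce {u : V | u ≠ v}) := by
  obtain ⟨w, rfl⟩ : ∃ l : List {u : V | u ≠ v}, l.map Subtype.val = w :=
    ⟨w.attachWith _ fun x hx => (hmem x).1 hx,
      (List.attachWith_map_val (f := id) _).trans w.map_id⟩
  refine ⟨w, fun x => ?_, fun x y hxy => ?_⟩
  · exact (List.mem_map_of_injective Subtype.val_injective).1 ((hmem x).2 x.2)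
  · rw [SimpleGraph.comap_adj]
    refine Iff.trans ?_ (hadj x y x.2 y.2 (Subtype.coe_injective.ne hxy))
    unfold Alternates
    change List.IsChain _ _ ↔ List.IsChain _ _
    simp only [List.filter_map, List.isChain_map, Function.comp_def, ne_eq, Subtype.ext_iff]

instance : DecidableRel D1.Adj
  | Sum.inl _, Sum.inl _ => decidable_of_iff' _ D1_adj_inl_inl
  | Sum.inr _, Sum.inl _ => decidable_of_iff' _ D1_adj_inr_inl
  | Sum.inl _, Sum.inr _ => decidable_of_iff' _ D1_adj_inl_inr
  | Sum.inr _, Sum.inr _ => isFalse not_D1_adj_inr_inr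

instance {V : Type*} [DecidableEq V] (w : List V) (x y : V) : Decidable (Alternates w x y) :=
  inferInstanceAs (Decidable (List.IsChain _ _))

/-- The words of `D1deletionWord`, with the vertices numbered clique first. -/
def D1deletionCode : Fin 6 ⊕ Fin 4 → List (Fin (6 + 4))
  | Sum.inl 0 => [1, 7, 3, 6, 2, 4, 6, 5, 1, 8, 3, 2, 8, 9, 4, 5, 9]
  | Sum.inl 1 => [0, 7, 2, 6, 3, 9, 5, 4, 9, 0, 8, 2, 3, 8, 5, 6, 4]
  | Sum.inl 2 => [0, 6, 9, 1, 8, 3, 8, 5, 4, 7, 0, 1, 7, 3, 9, 5, 6, 4, 9]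
  | Sum.inl 3 => [0, 6, 1, 9, 5, 4, 9, 2, 7, 0, 1, 7, 5, 6, 4, 8, 2]
  | Sum.inl 4 => [0, 6, 8, 1, 9, 5, 9, 3, 2, 7, 0, 1, 7, 5, 8, 3, 6, 2, 8]
  | Sum.inl 5 => [0, 6, 1, 8, 3, 2, 8, 4, 7, 0, 1, 7, 3, 6, 2, 9, 4]
  | Sum.inr 0 => [0, 1, 7, 8, 2, 3, 8, 9, 4, 5, 9, 0, 1, 2, 3, 4, 5]
  | Sum.inr 1 => [0, 2, 6, 3, 1, 9, 5, 4, 9, 0, 8, 2, 3, 8, 1, 5, 6, 4]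
  | Sum.inr 2 => [0, 6, 1, 3, 9, 5, 4, 9, 2, 7, 0, 1, 7, 3, 5, 6, 4, 2]
  | Sum.inr 3 => [0, 6, 1, 5, 8, 3, 2, 8, 4, 7, 0, 1, 7, 5, 3, 6, 2, 4]

/-- A word representing `D1` with the vertex `v` deleted. -/
def D1deletionWord (v : Fin 6 ⊕ Fin 4) : List (Fin 6 ⊕ Fin 4) :=
  (D1deletionCode v).map finSumFinEquiv.symm

theorem D1deletionWord_represents (v : Fin 6 ⊕ Fin 4) :
    (∀ x, (∃ y ∈ D1deletionWord v, y = x) ↔ x ≠ v) ∧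
      ∀ x y, x ≠ v → y ≠ v → x ≠ y →
        (Alternates (D1deletionWord v) x y ↔ D1.Adj x y) := by
  revert v
  decide +kernel

/-- `D₁` is a minimal non-word-representable graph: it is not word-representable, but
deleting any vertex yields a word-representable graph. -/
theorem stmt15 :
    ¬ WordRepresentable D1 ∧
      ∀ v : Fin 6 ⊕ Fin 4,
        WordRepresentable (D1.induce {u : Fin 6 ⊕ Fin 4 | u ≠ v}) := by
  refine ⟨not_wordRepresentable_D1, fun v => ?_⟩
  obtain ⟨hmem, hadj⟩ := D1deletionWord_represents v
  exact wordRepresentable_induce_ne _ (by simpa using hmem) hadj
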